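/- arXiv:2601.22932 — 9 statements merged into one kernel-verified Lean document; each statement's English description precedes it below -/
import Mathlib

section
/- Let q ≥ 2 be an integer. For all x, z in a real inner product space (e.g. ℝ^d), ‖x + z‖^q ≤ ‖x‖^q + q‖x‖^{q−2}⟨x, z⟩ + q(q−1)·2^{q−4}·(‖x‖^{q−2}‖z‖² + ‖z‖^q). -/
open scoped RealInnerProductSpace

theorem two_mul_pow_le_add_pow_add_sub_pow {m h : ℝ} (h0 : 0 ≤ h) (hm : h ≤ m) (n : ℕ) :
    2 * m ^ n ≤ (m + h) ^ n + (m - h) ^ n := by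
  have hm0 : 0 ≤ m := h0.trans hm
  induction n with
  | zero => norm_num
  | succ n ih =>
    have hD : (m - h) ^ n ≤ (m + h) ^ n := pow_le_pow_left₀ (by linarith) (by linarith) n
    have h1 := mul_le_mul_of_nonneg_left ih hm0
    have h2 := mul_le_mul_of_nonneg_left hD h0
    simp only [pow_succ]
    linarith

theorem two_mul_mul_pow_mul_le_add_pow_sub_sub_pow {m h : ℝ} (h0 : 0 ≤ h) (hm : h ≤ m) (n : ℕ) :
    2 * (n + 1) * m ^ n * h ≤ (m + h) ^ (n + 1) - (m - h) ^ (n + 1) := by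
  have hm0 : 0 ≤ m := h0.trans hm
  induction n with
  | zero => norm_num; linarith
  | succ n ih =>
    have h1 := mul_le_mul_of_nonneg_left ih hm0
    have h2 := mul_le_mul_of_nonneg_left
      (two_mul_pow_le_add_pow_add_sub_pow h0 hm (n + 1)) h0
    push_cast
    simp only [pow_succ] at *
    linarith

theorem add_mul_pow_add_pow_le {a b : ℝ} (ha : 0 ≤ a) (hb : 0 ≤ b) (n : ℕ) :
    (a + b) * (a ^ n + b ^ n) ≤ 2 * (a ^ (n + 1) + b ^ (n + 1)) := by
  have key : 0 ≤ (a - b) * (a ^ n - b ^ n) := by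
    rcases le_total a b with h | h
    · exact mul_nonneg_of_nonpos_of_nonpos (sub_nonpos.2 h)
        (sub_nonpos.2 (pow_le_pow_left₀ ha h n))
    · exact mul_nonneg (sub_nonneg.2 h) (sub_nonneg.2 (pow_le_pow_left₀ hb h n))
  simp only [pow_succ]
  linarith

/-- The first-order Taylor remainder of `t ↦ t ^ (n + 2)` at `a ≥ 0` with increment `b ≥ 0`. -/
theorem add_pow_le_taylor {a b : ℝ} (ha : 0 ≤ a) (hb : 0 ≤ b) (n : ℕ) :
    (a + b) ^ (n + 2) ≤ a ^ (n + 2) + (n + 2) * a ^ (n + 1) * b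
      + (n + 2) * (n + 1) * (2 ^ n / 4) * ((a ^ n + b ^ n) * b ^ 2) := by
  induction n with
  | zero => norm_num; nlinarith
  | succ n ih =>
    have h1 := mul_le_mul_of_nonneg_left ih (add_nonneg ha hb)
    have h2 : (n + 2) * (n + 1) * (2 ^ n / 4) * b ^ 2 * ((a + b) * (a ^ n + b ^ n)) ≤
        (n + 2) * (n + 1) * (2 ^ n / 4) * b ^ 2 * (2 * (a ^ (n + 1) + b ^ (n + 1))) :=
      mul_le_mul_of_nonneg_left (add_mul_pow_add_pow_le ha hb n) (by positivity)
    have h3 : (n + 2) * b ^ 2 * a ^ (n + 1) ≤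
        (n + 2) * b ^ 2 * (2 ^ n * (a ^ (n + 1) + b ^ (n + 1))) := by
      refine mul_le_mul_of_nonneg_left ?_ (by positivity)
      calc a ^ (n + 1) ≤ a ^ (n + 1) + b ^ (n + 1) := le_add_of_nonneg_right (by positivity)
        _ ≤ 2 ^ n * (a ^ (n + 1) + b ^ (n + 1)) :=
          le_mul_of_one_le_left (by positivity) (one_le_pow₀ one_le_two)
    push_cast
    simp only [pow_succ] at *
    linarith

/-- For `‖x + z‖` the deviation from the first-order Taylor expansion is largest when `x` and `z`
point in the same direction. -/
theorem norm_add_pow_le_add_norm_pow {E : Type*} [NormedAddCommGroup E] [InnerProductSpace ℝ E]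
    (n : ℕ) (x z : E) :
    ‖x + z‖ ^ (n + 2) ≤ (‖x‖ + ‖z‖) ^ (n + 2) - (n + 2) * ‖x‖ ^ n * (‖x‖ * ‖z‖ - ⟪x, z⟫) := by
  have hle : ‖x + z‖ ≤ ‖x‖ + ‖z‖ := norm_add_le x z
  have hge : ‖x‖ ≤ ‖x + z‖ + ‖z‖ := by simpa using norm_sub_le (x + z) z
  have hsq := norm_add_sq_real x z
  have hN := norm_nonneg (x + z)
  set m := (‖x‖ + ‖z‖ + ‖x + z‖) / 2 with hm
  set h := (‖x‖ + ‖z‖ - ‖x + z‖) / 2 with hh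
  have h0 : 0 ≤ h := by linarith
  have hhm : h ≤ m := by linarith
  have key := two_mul_mul_pow_mul_le_add_pow_sub_sub_pow h0 hhm (n + 1)
  have hadd : m + h = ‖x‖ + ‖z‖ := by rw [hm, hh]; ring
  have hsub : m - h = ‖x + z‖ := by rw [hm, hh]; ring
  have hmul : ‖x‖ * ‖z‖ - ⟪x, z⟫ = 2 * (m * h) := by
    rw [hm, hh]
    linear_combination hsq / 2
  rw [hadd, hsub] at key
  have hpow : (n + 2) * (2 * (m * h)) * ‖x‖ ^ n ≤ (n + 2) * (2 * (m * h)) * m ^ n := by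
    have hm0 : 0 ≤ m := h0.trans hhm
    exact mul_le_mul_of_nonneg_left
      (pow_le_pow_left₀ (norm_nonneg x) (by linarith) n) (by positivity)
  rw [hmul]
  push_cast at key
  rw [pow_succ m n] at key
  linarith

/-- For an integer `q ≥ 2` and all `x, z` in a real inner product space,
`‖x + z‖^q ≤ ‖x‖^q + q‖x‖^{q−2}⟨x,z⟩ + q(q−1)·2^{q−4}·(‖x‖^{q−2}‖z‖² + ‖z‖^q)`. -/
theorem norm_add_pow_le {E : Type*} [NormedAddCommGroup E] [InnerProductSpace ℝ E]
    (q : ℕ) (hq : 2 ≤ q) (x z : E) :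
    ‖x + z‖ ^ q ≤ ‖x‖ ^ q + (q : ℝ) * ‖x‖ ^ (q - 2) * ⟪x, z⟫
      + (q : ℝ) * ((q : ℝ) - 1) * (2 : ℝ) ^ ((q : ℤ) - 4)
        * (‖x‖ ^ (q - 2) * ‖z‖ ^ 2 + ‖z‖ ^ q) := by
  obtain ⟨n, rfl⟩ := Nat.exists_eq_add_of_le' hq
  have hC : (2 : ℝ) ^ (((n + 2 : ℕ) : ℤ) - 4) = 2 ^ n / 4 := by
    rw [zpow_sub₀ two_ne_zero, zpow_natCast, pow_add]
    norm_num
    ring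
  rw [hC, Nat.add_sub_cancel]
  have h1 := norm_add_pow_le_add_norm_pow n x z
  have h2 := add_pow_le_taylor (norm_nonneg x) (norm_nonneg z) n
  push_cast
  simp only [pow_succ] at *
  linarith
end

section
/- Let f : ℝ^d → ℝ be differentiable with L_f-Lipschitz gradient, and let r₁, r₂ : ℝ^d → ℝ be convex such that every subgradient of r₁ has norm at most G₁ and every subgradient of r₂ has norm at most G₂. Assume there exist μ > 0 and R₀ ≥ 0 such that for all x, y with ‖x − y‖ ≥ R₀ and all subgradients u₁ of r₁ at x, u₂ of r₂ at x, v₁ of r₁ at y, v₂ of r₂ at y: ⟨∇f(x) + u₁ − u₂ − ∇f(y) − v₁ + v₂, x − y⟩ ≥ μ‖x − y‖². Let λ > 0, γ₀ > 0 and 0 < γ ≤ γ₀. Define P(y) = prox_{γ r₁^λ}(y) and b(y) = (1/λ)(P(y) − prox_{λ r₁}(P(y))) + ∇f(P(y)) − (1/λ)(P(y) − prox_{λ r₂}(P(y))). Then for all x, y with ‖x − y‖ ≥ max{R₀, (8G₁ + 4L_f γ₀ G₁ + 4G₂)/μ}, one has ⟨b(x) − b(y), x − y⟩ ≥ (μ/2)‖x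 − y‖². -/
open scoped RealInnerProductSpace

/-- `u` is a subgradient of `g` at `x`. -/
def IsSubgradAt {d : ℕ} (g : EuclideanSpace ℝ (Fin d) → ℝ)
    (x u : EuclideanSpace ℝ (Fin d)) : Prop :=
  ∀ y, g x + ⟪u, y - x⟫ ≤ g y

/-- A real convex function on `ℝ^d` has a subgradient at every point. -/
theorem exists_isSubgradAt {d : ℕ} {g : EuclideanSpace ℝ (Fin d) → ℝ}
    (hg : ConvexOn ℝ Set.univ g) (x : EuclideanSpace ℝ (Fin d)) :
    ∃ u, IsSubgradAt g x u := by
  have hcont : Continuous g := hg.locallyLipschitz.continuous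
  have hconv := hg.convex_strict_epigraph
  have hopen : IsOpen {p : EuclideanSpace ℝ (Fin d) × ℝ | p.1 ∈ Set.univ ∧ g p.1 < p.2} := by
    simpa using isOpen_lt (hcont.comp continuous_fst) continuous_snd
  obtain ⟨φ, hφ⟩ := geometric_hahn_banach_open_point (x := (x, g x)) hconv hopen (by simp)
  set c : ℝ := φ (0, 1) with hc
  set l : StrongDual ℝ (EuclideanSpace ℝ (Fin d)) :=
    φ.comp (ContinuousLinearMap.inl ℝ (EuclideanSpace ℝ (Fin d)) ℝ) with hl
  have hsplit : ∀ z t, φ (z, t) = l z + t * c := fun z t => by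
    have : ((z, t) : EuclideanSpace ℝ (Fin d) × ℝ) = (z, 0) + t • (0, 1) := by simp
    rw [this, map_add, map_smul, smul_eq_mul]
    simp [hl, hc]
  have hlt : ∀ z t, g z < t → l z + t * c < l x + g x * c := fun z t h => by
    simpa only [hsplit] using hφ (z, t) ⟨Set.mem_univ _, h⟩
  have hcneg : c < 0 := by
    have := hlt x (g x + 1) (by linarith)
    linarith
  refine ⟨(InnerProductSpace.toDual ℝ _).symm ((-c)⁻¹ • l), fun y => ?_⟩
  rw [InnerProductSpace.toDual_symm_apply, smul_apply, smul_eq_mul, map_sub]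
  have hle : (-c)⁻¹ * (l y - l x) + g x ≤ g y := by
    refine le_of_forall_gt_imp_ge_of_dense fun t ht => ?_
    have h1 := hlt y t ht
    have h2 : (-c)⁻¹ * (l y - l x) ≤ t - g x := by
      rw [inv_mul_le_iff₀ (by linarith)]
      linarith
    linarith
  linarith

theorem nonneg_of_forall_add_mul_nonneg {a b : ℝ}
    (h : ∀ t : ℝ, 0 < t → t ≤ 1 → 0 ≤ a + t * b) : 0 ≤ a := by
  by_contra! ha
  have hb : 0 < |b| + 1 := by positivity
  have h1 := h (min 1 (-a / (2 * (|b| + 1)))) (lt_min one_pos (by apply div_pos <;> linarith))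
    (min_le_left _ _)
  have h2 : min 1 (-a / (2 * (|b| + 1))) * b ≤ -a / (2 * (|b| + 1)) * (|b| + 1) :=
    (mul_le_mul_of_nonneg_left (by linarith [le_abs_self b])
      (le_min zero_le_one (by apply div_nonneg <;> linarith))).trans
      (mul_le_mul_of_nonneg_right (min_le_right _ _) hb.le)
  have h3 : -a / (2 * (|b| + 1)) * (|b| + 1) = -a / 2 := by field_simp
  linarith

/-- The scaled displacement of the proximal point is a subgradient there. -/
theorem isSubgradAt_of_isMinOn_prox {d : ℕ} {g : EuclideanSpace ℝ (Fin d) → ℝ}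
    (hg : ConvexOn ℝ Set.univ g) {t : ℝ} (ht : 0 < t) {p a : EuclideanSpace ℝ (Fin d)}
    (ha : IsMinOn (fun y => g y + ‖p - y‖ ^ 2 / (2 * t)) Set.univ a) :
    IsSubgradAt g a ((1 / t) • (p - a)) := by
  intro w
  have key : 0 ≤ g w - g a - (1 / t) * ⟪p - a, w - a⟫ := by
    refine nonneg_of_forall_add_mul_nonneg (b := ‖w - a‖ ^ 2 / (2 * t)) fun s hs hs1 => ?_
    have h1 := ha (Set.mem_univ (a + s • (w - a)))
    simp only [Set.mem_ofPred_eq] at h1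
    have h2 := hg.2 (Set.mem_univ a) (Set.mem_univ w) (sub_nonneg.2 hs1) hs.le (by ring)
    have h3 : (1 - s) • a + s • w = a + s • (w - a) := by module
    rw [h3, smul_eq_mul, smul_eq_mul] at h2
    have h4 : p - (a + s • (w - a)) = (p - a) - s • (w - a) := by abel
    rw [h4, norm_sub_sq_real (p - a), norm_smul, inner_smul_right, mul_pow, Real.norm_eq_abs,
      sq_abs] at h1
    have h5 : (‖p - a‖ ^ 2 - 2 * (s * ⟪p - a, w - a⟫) + s ^ 2 * ‖w - a‖ ^ 2) / (2 * t)
        = ‖p - a‖ ^ 2 / (2 * t)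
          + s * (- (1 / t) * ⟪p - a, w - a⟫ + s * (‖w - a‖ ^ 2 / (2 * t))) := by
      field_simp
      ring
    rw [h5] at h1
    refine nonneg_of_mul_nonneg_right (a := s) ?_ hs
    linarith
  rw [real_inner_smul_left]
  linarith

/-- First-order optimality for the proximal point of a Moreau envelope. -/
theorem sub_eq_smul_of_isMinOn_moreau {d : ℕ} {g : EuclideanSpace ℝ (Fin d) → ℝ}
    {s t : ℝ} (hs : 0 < s) (ht : 0 < t) {x p a : EuclideanSpace ℝ (Fin d)}
    {q : EuclideanSpace ℝ (Fin d) → EuclideanSpace ℝ (Fin d)}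
    (hq : ∀ y, IsMinOn (fun z => g z + ‖y - z‖ ^ 2 / (2 * s)) Set.univ (q y))
    (ha : a = q p)
    (hp : IsMinOn (fun y => (⨅ z, (g z + ‖y - z‖ ^ 2 / (2 * s))) + ‖x - y‖ ^ 2 / (2 * t))
      Set.univ p) :
    x - p = t • ((1 / s) • (p - a)) := by
  have hbdd : ∀ y, BddBelow (Set.range fun z => g z + ‖y - z‖ ^ 2 / (2 * s)) := fun y =>
    ⟨g (q y) + ‖y - q y‖ ^ 2 / (2 * s), by
      rintro _ ⟨z, rfl⟩
      exact hq y (Set.mem_univ z)⟩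
  have hle : ∀ y, ‖p - a‖ ^ 2 / (2 * s) + ‖x - p‖ ^ 2 / (2 * t)
      ≤ ‖y - a‖ ^ 2 / (2 * s) + ‖x - y‖ ^ 2 / (2 * t) := fun y => by
    have h1 := hp (Set.mem_univ y)
    simp only [Set.mem_ofPred_eq] at h1
    have h2 : g a + ‖p - a‖ ^ 2 / (2 * s) ≤ ⨅ z, (g z + ‖p - z‖ ^ 2 / (2 * s)) :=
      le_ciInf fun z => ha ▸ hq p (Set.mem_univ z)
    have h3 := ciInf_le (hbdd y) a
    linarith
  set v := (1 / t) • (x - p) - (1 / s) • (p - a) with hv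
  have key : 0 ≤ -‖v‖ ^ 2 := by
    refine nonneg_of_forall_add_mul_nonneg
      (b := ‖v‖ ^ 2 / (2 * s) + ‖v‖ ^ 2 / (2 * t)) fun r hr _ => ?_
    have h1 := hle (p + r • v)
    have h2 : p + r • v - a = (p - a) + r • v := by abel
    have h3 : x - (p + r • v) = (x - p) - r • v := by abel
    rw [h2, h3, norm_sub_sq_real (x - p), norm_add_sq_real (p - a), norm_smul, inner_smul_right,
      inner_smul_right, mul_pow, Real.norm_eq_abs, sq_abs] at h1
    have h4 : ‖v‖ ^ 2 = (1 / t) * ⟪x - p, v⟫ - (1 / s) * ⟪p - a, v⟫ := by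
      rw [← real_inner_smul_left, ← real_inner_smul_left, ← inner_sub_left, ← hv,
        real_inner_self_eq_norm_sq]
    have h5 : (‖p - a‖ ^ 2 + 2 * (r * ⟪p - a, v⟫) + r ^ 2 * ‖v‖ ^ 2) / (2 * s)
        + (‖x - p‖ ^ 2 - 2 * (r * ⟪x - p, v⟫) + r ^ 2 * ‖v‖ ^ 2) / (2 * t)
        = ‖p - a‖ ^ 2 / (2 * s) + ‖x - p‖ ^ 2 / (2 * t)
          + r * (-((1 / t) * ⟪x - p, v⟫ - (1 / s) * ⟪p - a, v⟫)
            + r * (‖v‖ ^ 2 / (2 * s) + ‖v‖ ^ 2 / (2 * t))) := by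
      field_simp
      ring
    rw [h5, ← h4] at h1
    refine nonneg_of_mul_nonneg_right (a := r) ?_ hr
    linarith
  have hv0 : v = 0 := by
    have : ‖v‖ ^ 2 = 0 := le_antisymm (by linarith) (sq_nonneg _)
    simpa using this
  rw [← sub_eq_zero.1 hv0, smul_smul, mul_one_div_cancel ht.ne', one_smul]

/-- The subdifferential of any function is monotone. -/
theorem IsSubgradAt.inner_sub_nonneg {d : ℕ} {g : EuclideanSpace ℝ (Fin d) → ℝ}
    {x y u v : EuclideanSpace ℝ (Fin d)} (hu : IsSubgradAt g x u) (hv : IsSubgradAt g y v) :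
    0 ≤ ⟪u - v, x - y⟫ := by
  have h1 := hu y
  have h2 := hv x
  rw [← neg_sub x y, inner_neg_right] at h1
  rw [inner_sub_left]
  linarith

theorem neg_mul_le_inner_of_norm_le {E : Type*} [NormedAddCommGroup E] [InnerProductSpace ℝ E]
    {u w : E} {c : ℝ} (hu : ‖u‖ ≤ c) : -(c * ‖w‖) ≤ ⟪u, w⟫ :=
  (neg_le_neg (mul_le_mul_of_nonneg_right hu (norm_nonneg w))).trans
    (neg_le_of_abs_le (abs_real_inner_le_norm u w))

/-- Distant dissipativity of the DC-LA drift
`b(y) = ∇r₁^λ(P y) + ∇f(P y) − ∇r₂^λ(P y)` where `P = prox_{γ r₁^λ}`, under bounded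
subgradients of `r₁, r₂` and distant dissipativity of the generalized gradient of `V`. -/
theorem drift_distant_dissipative {d : ℕ}
    (f r1 r2 : EuclideanSpace ℝ (Fin d) → ℝ)
    (f' : EuclideanSpace ℝ (Fin d) → EuclideanSpace ℝ (Fin d))
    (Lf G1 G2 mu R0 lam gam gam0 : ℝ)
    (hf : ∀ x, HasGradientAt f (f' x) x)
    (hLf : ∀ x y, ‖f' x - f' y‖ ≤ Lf * ‖x - y‖)
    (hr1 : ConvexOn ℝ Set.univ r1) (hr2 : ConvexOn ℝ Set.univ r2)
    (hG1 : ∀ x u, IsSubgradAt r1 x u → ‖u‖ ≤ G1)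
    (hG2 : ∀ x u, IsSubgradAt r2 x u → ‖u‖ ≤ G2)
    (hmu : 0 < mu) (hR0 : 0 ≤ R0)
    (hdiss : ∀ x y u1 u2 v1 v2, R0 ≤ ‖x - y‖ →
      IsSubgradAt r1 x u1 → IsSubgradAt r2 x u2 →
      IsSubgradAt r1 y v1 → IsSubgradAt r2 y v2 →
      mu * ‖x - y‖ ^ 2 ≤ ⟪f' x + u1 - u2 - f' y - v1 + v2, x - y⟫)
    (hlam : 0 < lam) (hgam0 : 0 < gam0) (hgam : 0 < gam) (hgamle : gam ≤ gam0)
    (P prox1 prox2 : EuclideanSpace ℝ (Fin d) → EuclideanSpace ℝ (Fin d))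
    (hP : ∀ x, IsMinOn
      (fun y => (⨅ z, (r1 z + ‖y - z‖ ^ 2 / (2 * lam))) + ‖x - y‖ ^ 2 / (2 * gam))
      Set.univ (P x))
    (hprox1 : ∀ x, IsMinOn (fun y => r1 y + ‖x - y‖ ^ 2 / (2 * lam)) Set.univ (prox1 x))
    (hprox2 : ∀ x, IsMinOn (fun y => r2 y + ‖x - y‖ ^ 2 / (2 * lam)) Set.univ (prox2 x))
    (b : EuclideanSpace ℝ (Fin d) → EuclideanSpace ℝ (Fin d))
    (hb : ∀ y, b y = (1 / lam) • (P y - prox1 (P y)) + f' (P y)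
      - (1 / lam) • (P y - prox2 (P y)))
    (x y : EuclideanSpace ℝ (Fin d))
    (hxy : max R0 ((8 * G1 + 4 * Lf * gam0 * G1 + 4 * G2) / mu) ≤ ‖x - y‖) :
    (mu / 2) * ‖x - y‖ ^ 2 ≤ ⟪b x - b y, x - y⟫ := by
  have hs : ∀ z, ‖(1 / lam) • (P z - prox1 (P z))‖ ≤ G1 := fun z =>
    hG1 _ _ (isSubgradAt_of_isMinOn_prox hr1 hlam (hprox1 (P z)))
  have ht : ∀ z, ‖(1 / lam) • (P z - prox2 (P z))‖ ≤ G2 := fun z =>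
    hG2 _ _ (isSubgradAt_of_isMinOn_prox hr2 hlam (hprox2 (P z)))
  have hG1nn : 0 ≤ G1 := (norm_nonneg _).trans (hs x)
  rcases (norm_nonneg (x - y)).eq_or_lt with hD | hD
  · have : x - y = 0 := norm_eq_zero.1 hD.symm
    simp [this]
  have hLfnn : 0 ≤ Lf :=
    nonneg_of_mul_nonneg_left ((norm_nonneg _).trans (hLf x y)) hD
  have hmove : ∀ z, ‖f' (P z) - f' z‖ ≤ Lf * gam0 * G1 := fun z => by
    have h := sub_eq_smul_of_isMinOn_moreau hlam hgam hprox1 rfl (hP z)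
    calc ‖f' (P z) - f' z‖ ≤ Lf * ‖P z - z‖ := hLf _ _
      _ = Lf * (gam * ‖(1 / lam) • (P z - prox1 (P z))‖) := by
          rw [norm_sub_rev, h, norm_smul gam, Real.norm_of_nonneg hgam.le]
      _ ≤ Lf * (gam0 * G1) := by
          have := hs z
          gcongr
      _ = Lf * gam0 * G1 := by ring
  obtain ⟨u1, hu1⟩ := exists_isSubgradAt hr1 x
  obtain ⟨u2, hu2⟩ := exists_isSubgradAt hr2 x
  obtain ⟨v1, hv1⟩ := exists_isSubgradAt hr1 y
  obtain ⟨v2, hv2⟩ := exists_isSubgradAt hr2 y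
  have hdis := hdiss x y u1 u2 v1 v2 ((le_max_left _ _).trans hxy) hu1 hu2 hv1 hv2
  have hmon := hu2.inner_sub_nonneg hv2
  have hthr : 8 * G1 + 4 * Lf * gam0 * G1 + 4 * G2 ≤ mu * ‖x - y‖ := by
    have := (le_max_right _ _).trans hxy
    rwa [div_le_iff₀' hmu] at this
  set e := ((1 / lam) • (P x - prox1 (P x)) - (1 / lam) • (P y - prox1 (P y)))
    - ((1 / lam) • (P x - prox2 (P x)) - (1 / lam) • (P y - prox2 (P y)))
    + ((f' (P x) - f' x) - (f' (P y) - f' y)) - (u1 - v1) with he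
  have hsplit : b x - b y = (f' x + u1 - u2 - f' y - v1 + v2) + (u2 - v2) + e := by
    rw [hb, hb, he]
    abel
  have henorm : ‖e‖ ≤ (G1 + G1) + (G2 + G2) + (Lf * gam0 * G1 + Lf * gam0 * G1) + (G1 + G1) :=
    norm_sub_le_of_le
      (norm_add_le_of_le
        (norm_sub_le_of_le (norm_sub_le_of_le (hs x) (hs y)) (norm_sub_le_of_le (ht x) (ht y)))
        (norm_sub_le_of_le (hmove x) (hmove y)))
      (norm_sub_le_of_le (hG1 _ _ hu1) (hG1 _ _ hv1))
  have herr := neg_mul_le_inner_of_norm_le (w := x - y) henorm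
  have hG2nn : 0 ≤ G2 := (norm_nonneg _).trans (ht x)
  have hscaled := mul_le_mul_of_nonneg_right hthr hD.le
  rw [hsplit, inner_add_left, inner_add_left]
  linarith
end

section
/- Let f : ℝ^d → ℝ be differentiable with ∇f being (μ, R)-distant dissipative for some μ > 0, R ≥ 0, let r₁ : ℝ^d → ℝ be convex, and let r₂ : ℝ^d → ℝ be convex with every subgradient of norm at most G₂. Then for all x, y with ‖x − y‖ ≥ max{R, 4G₂/μ} and all subgradients u₁ of r₁ at x, u₂ of r₂ at x, v₁ of r₁ at y, v₂ of r₂ at y: ⟨∇f(x) + u₁ − u₂ − ∇f(y) − v₁ + v₂, x − y⟩ ≥ (μ/2)‖x − y‖². -/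
open scoped RealInnerProductSpace

/-- If `∇f` is `(μ, R)`-distant dissipative and every subgradient of the
convex `r₂` has norm at most `G₂`, then the generalized gradient of `V = f + r₁ − r₂` is
`(μ/2, max{R, 4G₂/μ})`-distant dissipative. -/
theorem generalized_gradient_distant_dissipative {d : ℕ}
    (f r1 r2 : EuclideanSpace ℝ (Fin d) → ℝ)
    (f' : EuclideanSpace ℝ (Fin d) → EuclideanSpace ℝ (Fin d))
    (G2 mu R : ℝ)
    (hf : ∀ x, HasGradientAt f (f' x) x)
    (hmu : 0 < mu) (hR : 0 ≤ R)
    (hdiss : ∀ x y, R ≤ ‖x - y‖ → mu * ‖x - y‖ ^ 2 ≤ ⟪f' x - f' y, x - y⟫)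
    (hr1 : ConvexOn ℝ Set.univ r1) (hr2 : ConvexOn ℝ Set.univ r2)
    (hG2 : ∀ x u, IsSubgradAt r2 x u → ‖u‖ ≤ G2)
    (x y u1 u2 v1 v2 : EuclideanSpace ℝ (Fin d))
    (hxy : max R (4 * G2 / mu) ≤ ‖x - y‖)
    (hu1 : IsSubgradAt r1 x u1) (hu2 : IsSubgradAt r2 x u2)
    (hv1 : IsSubgradAt r1 y v1) (hv2 : IsSubgradAt r2 y v2) :
    (mu / 2) * ‖x - y‖ ^ 2 ≤ ⟪f' x + u1 - u2 - f' y - v1 + v2, x - y⟫ := by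
  have hf_mono := hdiss x y ((le_max_left _ _).trans hxy)
  have hr1_mono := hu1.inner_sub_nonneg hv1
  have hbound : ‖u2 - v2‖ ≤ 2 * G2 := by
    linarith [norm_sub_le u2 v2, hG2 x u2 hu2, hG2 y v2 hv2]
  have hdist : 4 * G2 ≤ ‖x - y‖ * mu :=
    (div_le_iff₀ hmu).mp ((le_max_right _ _).trans hxy)
  have hr2_bound : ⟪u2 - v2, x - y⟫ ≤ mu / 2 * ‖x - y‖ ^ 2 :=
    calc ⟪u2 - v2, x - y⟫ ≤ ‖u2 - v2‖ * ‖x - y‖ := real_inner_le_norm _ _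
      _ ≤ (mu / 2 * ‖x - y‖) * ‖x - y‖ := by gcongr; linarith
      _ = mu / 2 * ‖x - y‖ ^ 2 := by ring
  have hsplit : f' x + u1 - u2 - f' y - v1 + v2 = (f' x - f' y) + (u1 - v1) - (u2 - v2) := by
    abel
  rw [hsplit, inner_sub_left, inner_add_left]
  linarith
end

section
/- Let f : ℝ^d → ℝ be differentiable with ∇f being (μ, R)-distant dissipative for some μ > 0, R ≥ 0, let r₁ : ℝ^d → ℝ be convex, and let r₂ : ℝ^d → ℝ be convex and differentiable with ‖∇r₂(x) − ∇r₂(y)‖ ≤ M‖x − y‖^κ for all x, y, where κ ∈ (0,1) and M > 0. Then for all x, y with ‖x − y‖ ≥ max{R, (2M/μ)^{1/(1−κ)}} and all subgradients u₁ of r₁ at x, v₁ of r₁ at y: ⟨∇f(x) + u₁ − ∇r₂(x) − ∇f(y) − v₁ + ∇r₂(y), x − y⟩ ≥ (μ/2)‖x − y‖². -/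
open scoped RealInnerProductSpace

/-- Beyond the radius `(2M/μ)^{1/(1-κ)}`, Hölder growth is dominated by linear growth. -/
theorem mul_rpow_le_half_mul_of_rpow_le {M kap mu t : ℝ} (hM : 0 < M) (hmu : 0 < mu)
    (hkap1 : kap < 1) (ht : (2 * M / mu) ^ (1 / (1 - kap)) ≤ t) :
    M * t ^ kap ≤ mu / 2 * t := by
  have hbase : 0 < 2 * M / mu := by positivity
  have ht0 : 0 < t := (Real.rpow_pos_of_pos hbase _).trans_le ht
  have hk : 0 < 1 - kap := sub_pos.mpr hkap1
  have hle : 2 * M / mu ≤ t ^ (1 - kap) := by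
    rw [one_div] at ht
    exact (Real.rpow_inv_le_iff_of_pos hbase.le ht0.le hk).mp ht
  have hM' : M ≤ mu / 2 * t ^ (1 - kap) := by
    rw [div_le_iff₀ hmu] at hle
    linarith
  calc M * t ^ kap ≤ mu / 2 * t ^ (1 - kap) * t ^ kap := by gcongr
    _ = mu / 2 * t := by
      rw [mul_assoc, ← Real.rpow_add ht0, sub_add_cancel, Real.rpow_one]

/-- If `∇f` is `(μ, R)`-distant dissipative and `r₂` is convex and
differentiable with `(κ, M)`-Hölder continuous gradient (`κ ∈ (0,1)`), then the
generalized gradient of `V = f + r₁ − r₂` is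
`(μ/2, max{R, (2M/μ)^{1/(1−κ)}})`-distant dissipative. -/
theorem generalized_gradient_distant_dissipative_holder {d : ℕ}
    (f r1 r2 : EuclideanSpace ℝ (Fin d) → ℝ)
    (f' r2' : EuclideanSpace ℝ (Fin d) → EuclideanSpace ℝ (Fin d))
    (M kap mu R : ℝ)
    (hf : ∀ x, HasGradientAt f (f' x) x)
    (hmu : 0 < mu) (hR : 0 ≤ R)
    (hdiss : ∀ x y, R ≤ ‖x - y‖ → mu * ‖x - y‖ ^ 2 ≤ ⟪f' x - f' y, x - y⟫)
    (hr1 : ConvexOn ℝ Set.univ r1) (hr2 : ConvexOn ℝ Set.univ r2)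
    (hr2' : ∀ x, HasGradientAt r2 (r2' x) x)
    (hkap : 0 < kap) (hkap1 : kap < 1) (hM : 0 < M)
    (hHolder : ∀ x y, ‖r2' x - r2' y‖ ≤ M * ‖x - y‖ ^ kap)
    (x y u1 v1 : EuclideanSpace ℝ (Fin d))
    (hxy : max R ((2 * M / mu) ^ (1 / (1 - kap))) ≤ ‖x - y‖)
    (hu1 : IsSubgradAt r1 x u1) (hv1 : IsSubgradAt r1 y v1) :
    (mu / 2) * ‖x - y‖ ^ 2 ≤ ⟪f' x + u1 - r2' x - f' y - v1 + r2' y, x - y⟫ := by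
  have hf_lower := hdiss x y ((le_max_left _ _).trans hxy)
  have hr1_mono := hu1.inner_sub_nonneg hv1
  have hgrowth := mul_rpow_le_half_mul_of_rpow_le hM hmu hkap1 ((le_max_right _ _).trans hxy)
  have hr2_upper : ⟪r2' x - r2' y, x - y⟫ ≤ mu / 2 * ‖x - y‖ ^ 2 :=
    calc ⟪r2' x - r2' y, x - y⟫ ≤ ‖r2' x - r2' y‖ * ‖x - y‖ := real_inner_le_norm _ _
      _ ≤ mu / 2 * ‖x - y‖ * ‖x - y‖ := by
        gcongr
        exact (hHolder x y).trans hgrowth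
      _ = mu / 2 * ‖x - y‖ ^ 2 := by ring
  have hsplit : f' x + u1 - r2' x - f' y - v1 + r2' y
      = (f' x - f' y) + (u1 - v1) - (r2' x - r2' y) := by abel
  rw [hsplit, inner_sub_left, inner_add_left]
  linarith
end

section
/- Let ρ > 0, L_r > 0, μ > 0, R₀ ≥ 0 and let r : ℝ^d → ℝ be ρ-weakly convex, i.e., x ↦ r(x) + (ρ/2)‖x‖² is convex. Fix γ ∈ (0, 1/ρ), so that prox_{γ r}(x), the unique minimizer of y ↦ r(y) + ‖x − y‖²/(2γ), is well defined for every x. Assume: (i) r is differentiable at every point of the image prox_{γ r}(ℝ^d), and ‖∇r(prox_{γ r}(x)) − ∇r(prox_{γ r}(y))‖ ≤ L_r ‖prox_{γ r}(x) − prox_{γ r}(y)‖ for all x, y; (ii) writing T(x) = (x − prox_{γ r}(x))/γ, one has ⟨T(x) − T(y), x − y⟩ ≥ μ‖x − y‖² for all x, y such that the closed segment from x to y is disjoint from the closed ball of radius R₀ centered at the origin. Then μ(1 − γρ) ≤ L_r; in particular, if γ < 3/(4ρ) then μ < 4L_r, so the requirement μ ≥ 8L_f + 4L_r (with L_f ≥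 0) cannot hold. -/
open scoped RealInnerProductSpace

section Gradient

variable {E : Type*} [NormedAddCommGroup E] [InnerProductSpace ℝ E]

/-- The tangent of a convex function at a point of differentiability lies below its graph. -/
theorem ConvexOn.hasFDerivAt_apply_sub_le {g : E → ℝ} (hg : ConvexOn ℝ Set.univ g)
    {x : E} {g' : E →L[ℝ] ℝ} (h : HasFDerivAt g g' x) (y : E) :
    g' (y - x) ≤ g y - g x := by
  have hline : ConvexOn ℝ Set.univ (g ∘ AffineMap.lineMap (k := ℝ) x y) := by
    simpa using hg.comp_affineMap (AffineMap.lineMap (k := ℝ) x y)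
  have hderiv : HasDerivAt (g ∘ AffineMap.lineMap (k := ℝ) x y) (g' (y - x)) 0 := by
    refine HasFDerivAt.comp_hasDerivAt (0 : ℝ) ?_ AffineMap.hasDerivAt_lineMap
    simpa using h
  simpa [slope_def_field] using
    hline.le_slope_of_hasDerivAt (Set.mem_univ 0) (Set.mem_univ 1) zero_lt_one hderiv

variable [CompleteSpace E]

/-- The gradient of a weakly convex function is hypomonotone. -/
theorem inner_gradient_sub_ge_of_weaklyConvex {r : E → ℝ} {rho : ℝ}
    (hweak : ConvexOn ℝ Set.univ (fun x => r x + rho / 2 * ‖x‖ ^ 2))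
    {p q u v : E} (hp : HasGradientAt r u p) (hq : HasGradientAt r v q) :
    -rho * ‖p - q‖ ^ 2 ≤ ⟪u - v, p - q⟫ := by
  have hsum (a w : E) (ha : HasGradientAt r w a) :=
    ha.hasFDerivAt.add ((hasStrictFDerivAt_norm_sq a).hasFDerivAt.const_mul (rho / 2))
  have h₁ := hweak.hasFDerivAt_apply_sub_le (hsum p u hp) q
  have h₂ := hweak.hasFDerivAt_apply_sub_le (hsum q v hq) p
  simp [inner_sub_right] at h₁ h₂
  rw [norm_sub_sq_real, inner_sub_left, inner_sub_right, inner_sub_right]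
  have hc := real_inner_comm p q
  simp only [hc] at *
  linarith

/-- First-order optimality condition for the proximal problem. -/
theorem gradient_eq_of_isMinOn_prox {r : E → ℝ} {gam : ℝ} {x p u : E}
    (hmin : IsMinOn (fun y => r y + ‖x - y‖ ^ 2 / (2 * gam)) Set.univ p)
    (hp : HasGradientAt r u p) : u = (1 / gam) • (x - p) := by
  have hnorm : HasFDerivAt (fun y => ‖x - y‖ ^ 2) _ p :=
    ((hasFDerivAt_id p).const_sub x).norm_sq
  have hzero := (hmin.isLocalMin Filter.univ_mem).hasFDerivAt_eq_zero
    (hp.hasFDerivAt.add (hnorm.mul_const (2 * gam)⁻¹))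
  refine ext_inner_right ℝ fun w => ?_
  have happly := congrArg (fun f : E →L[ℝ] ℝ => f w) hzero
  simp at happly
  rw [real_inner_smul_left, inner_sub_left]
  field_simp at happly
  linear_combination happly

end Gradient

/-- Assumption 3 of Renaud et al. (2025) is impossible to satisfy:
for a `ρ`-weakly convex `r` with `γ ∈ (0, 1/ρ)`, if `r` is smooth on the proximal image
with constant `L_r` and the gradient `T` of the Moreau envelope `r^γ` is `μ`-strongly
monotone outside the ball of radius `R₀`, then `μ(1 − γρ) ≤ L_r`; in particular, if
`γ < 3/(4ρ)` then `μ < 4 L_r`, so `μ ≥ 8 L_f + 4 L_r` (with `L_f ≥ 0`) cannot hold. -/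
theorem renaud_assumption_impossible {d : ℕ} (hd : 1 ≤ d)
    (r : EuclideanSpace ℝ (Fin d) → ℝ)
    (rho Lr mu R0 gam : ℝ)
    (hrho : 0 < rho) (hLr : 0 < Lr) (hmu : 0 < mu) (hR0 : 0 ≤ R0)
    (hgam : 0 < gam) (hgam' : gam < 1 / rho)
    (hweak : ConvexOn ℝ Set.univ (fun x => r x + rho / 2 * ‖x‖ ^ 2))
    (prox : EuclideanSpace ℝ (Fin d) → EuclideanSpace ℝ (Fin d))
    (hprox : ∀ x, IsMinOn (fun y => r y + ‖x - y‖ ^ 2 / (2 * gam)) Set.univ (prox x))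
    (r' : EuclideanSpace ℝ (Fin d) → EuclideanSpace ℝ (Fin d))
    (hdiff : ∀ x, HasGradientAt r (r' (prox x)) (prox x))
    (hLip : ∀ x y, ‖r' (prox x) - r' (prox y)‖ ≤ Lr * ‖prox x - prox y‖)
    (T : EuclideanSpace ℝ (Fin d) → EuclideanSpace ℝ (Fin d))
    (hT : ∀ x, T x = (1 / gam) • (x - prox x))
    (hmono : ∀ x y : EuclideanSpace ℝ (Fin d),
      (∀ z ∈ segment ℝ x y, R0 < ‖z‖) →
      mu * ‖x - y‖ ^ 2 ≤ ⟪T x - T y, x - y⟫) :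
    mu * (1 - gam * rho) ≤ Lr ∧ (gam < 3 / (4 * rho) → mu < 4 * Lr) := by
  have hopt (x) : r' (prox x) = (1 / gam) • (x - prox x) :=
    gradient_eq_of_isMinOn_prox (hprox x) (hdiff x)
  have hgr : 0 < 1 - gam * rho := by
    rw [lt_div_iff₀ hrho] at hgam'
    linarith
  have hprox_lip (x y) : (1 - gam * rho) * ‖prox x - prox y‖ ≤ ‖x - y‖ := by
    have hhypo := inner_gradient_sub_ge_of_weaklyConvex hweak (hdiff x) (hdiff y)
    have hsplit : x - y = (prox x - prox y) + gam • (r' (prox x) - r' (prox y)) := by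
      rw [hopt, hopt, ← smul_sub, smul_smul, mul_one_div_cancel hgam.ne', one_smul]
      abel
    have hinner : ⟪x - y, prox x - prox y⟫ =
        ‖prox x - prox y‖ ^ 2 + gam * ⟪r' (prox x) - r' (prox y), prox x - prox y⟫ := by
      conv_lhs => rw [hsplit]
      rw [inner_add_left, real_inner_self_eq_norm_sq, real_inner_smul_left]
    have hcs := real_inner_le_norm (x - y) (prox x - prox y)
    have hscaled := mul_le_mul_of_nonneg_left hhypo hgam.le
    rcases (norm_nonneg (prox x - prox y)).eq_or_lt with h | h
    · rw [← h, mul_zero]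
      exact norm_nonneg _
    · refine le_of_mul_le_mul_right ?_ h
      nlinarith
  have hmain : mu * (1 - gam * rho) ≤ Lr := by
    set e : EuclideanSpace ℝ (Fin d) := EuclideanSpace.single ⟨0, hd⟩ 1
    have he : ‖e‖ = 1 := by simp [e]
    set x := (R0 + 2) • e with hx
    set y := (R0 + 1) • e with hy
    have hxy : ‖x - y‖ = 1 := by
      rw [hx, hy, ← sub_smul, norm_smul, he]
      norm_num
    have hseg : ∀ z ∈ segment ℝ x y, R0 < ‖z‖ := by
      rintro z ⟨a, b, ha, hb, hab, rfl⟩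
      rw [hx, hy, smul_smul, smul_smul, ← add_smul, norm_smul, he, mul_one, Real.norm_eq_abs]
      refine lt_of_lt_of_le ?_ (le_abs_self _)
      obtain rfl : b = 1 - a := by linarith
      linarith
    have hTxy := hmono x y hseg
    have hcs := real_inner_le_norm (T x - T y) (x - y)
    have hlip := hLip x y
    have hpl := hprox_lip x y
    rw [hopt, hopt, ← hT, ← hT] at hlip
    rw [hxy] at hTxy hcs hpl
    have hmu_le : mu ≤ Lr * ‖prox x - prox y‖ := by linarith
    calc mu * (1 - gam * rho) ≤ Lr * ‖prox x - prox y‖ * (1 - gam * rho) := by gcongr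
      _ = Lr * ((1 - gam * rho) * ‖prox x - prox y‖) := by ring
      _ ≤ Lr * 1 := by gcongr
      _ = Lr := mul_one _
  refine ⟨hmain, fun hsmall => ?_⟩
  rw [lt_div_iff₀ (by positivity)] at hsmall
  nlinarith
end

section
/- For every integer d ≥ 2 and every α > 0, the function x ↦ ‖x‖₁ − ‖x‖₂ + α‖x‖₂² is not convex on ℝ^d. Consequently, the ℓ₁ − ℓ₂ regularizer x ↦ ‖x‖₁ − ‖x‖₂ is not weakly convex. -/
/-- Adding a positive multiple of `‖x‖₂²` does not make `‖x‖₁ − ‖x‖₂` convex: convexity fails at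
the midpoint of two short multiples of distinct coordinate vectors. -/
theorem not_convexOn_l1_sub_l2_add_sq {d : ℕ} (hd : 2 ≤ d) {α : ℝ} (hα : 0 < α) :
    ¬ ConvexOn ℝ Set.univ
        (fun x : EuclideanSpace ℝ (Fin d) => (∑ i, |x i|) - ‖x‖ + α * ‖x‖ ^ 2) := by
  obtain ⟨n, rfl⟩ := Nat.exists_eq_add_of_le' hd
  intro h
  obtain ⟨s, hs, hαs⟩ : ∃ s : ℝ, 0 < s ∧ α * s = 1 / 2 :=
    ⟨1 / (2 * α), by positivity, by field_simp⟩
  let u : EuclideanSpace ℝ (Fin (n + 2)) := EuclideanSpace.single 0 s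
  let v : EuclideanSpace ℝ (Fin (n + 2)) := EuclideanSpace.single 1 s
  let m : EuclideanSpace ℝ (Fin (n + 2)) := (1 / 2 : ℝ) • u + (1 / 2 : ℝ) • v
  have key : (∑ i, |m i|) - ‖m‖ + α * ‖m‖ ^ 2 ≤
      (1 / 2 : ℝ) • ((∑ i, |u i|) - ‖u‖ + α * ‖u‖ ^ 2) +
      (1 / 2 : ℝ) • ((∑ i, |v i|) - ‖v‖ + α * ‖v‖ ^ 2) :=
    h.2 (Set.mem_univ u) (Set.mem_univ v) (by norm_num) (by norm_num) (by norm_num)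
  have hu : ‖u‖ = s := by simp [u, abs_of_pos hs]
  have hv : ‖v‖ = s := by simp [v, abs_of_pos hs]
  have split (f : Fin (n + 2) → ℝ) : ∑ i, f i = f 0 + (f 1 + ∑ i : Fin n, f i.succ.succ) := by
    rw [Fin.sum_univ_succ, Fin.sum_univ_succ, Fin.succ_zero_eq_one]
  have u0 : u 0 = s := by simp [u]
  have u1 : u 1 = 0 := by simp [u]
  have us (i : Fin n) : u i.succ.succ = 0 := by simp [u]
  have v0 : v 0 = 0 := by simp [v]
  have v1 : v 1 = s := by simp [v]
  have vs (i : Fin n) : v i.succ.succ = 0 := by simp [v, Fin.ext_iff]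
  have m0 : m 0 = s / 2 := by simp [m, u0, v0]; ring
  have m1 : m 1 = s / 2 := by simp [m, u1, v1]; ring
  have ms (i : Fin n) : m i.succ.succ = 0 := by simp [m, us, vs]
  have hu1 : ∑ i, |u i| = s := by
    simp [split, u0, u1, us, abs_of_pos hs]
  have hv1 : ∑ i, |v i| = s := by
    simp [split, v0, v1, vs, abs_of_pos hs]
  have hm1 : ∑ i, |m i| = s := by
    simp [split, m0, m1, ms, abs_of_pos (half_pos hs)]
  have hm : ‖m‖ ^ 2 = s ^ 2 / 2 := by
    simp only [EuclideanSpace.real_norm_sq_eq, split, m0, m1, ms]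
    simp
    ring
  have hm_lt : ‖m‖ < 3 / 4 * s := by
    apply lt_of_pow_lt_pow_left₀ 2 (by positivity)
    rw [hm]
    nlinarith [pow_pos hs 2]
  rw [hu, hv, hu1, hv1, hm1, hm, smul_eq_mul] at key
  have hαs2 : α * s ^ 2 = s / 2 := by linear_combination s * hαs
  linarith

/-- For `d ≥ 2` and any `α > 0`, the function
`x ↦ ‖x‖₁ − ‖x‖₂ + α‖x‖₂²` is not convex on `ℝ^d`; consequently the `ℓ₁ − ℓ₂`
regularizer is not weakly convex. -/
theorem l1_sub_l2_not_weakly_convex (d : ℕ) (hd : 2 ≤ d) (α : ℝ) (hα : 0 < α) :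
    ¬ ConvexOn ℝ Set.univ
        (fun x : EuclideanSpace ℝ (Fin d) => (∑ i, |x i|) - ‖x‖ + α * ‖x‖ ^ 2) ∧
    ¬ ∃ ρ : ℝ, 0 < ρ ∧ ConvexOn ℝ Set.univ
        (fun x : EuclideanSpace ℝ (Fin d) =>
          ((∑ i, |x i|) - ‖x‖) + ρ / 2 * ‖x‖ ^ 2) := by
  refine ⟨not_convexOn_l1_sub_l2_add_sq hd hα, ?_⟩
  rintro ⟨ρ, hρ, h⟩
  exact not_convexOn_l1_sub_l2_add_sq hd (half_pos hρ) h
end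

section
/- For every θ > 0, every α > 0 and every integer d ≥ 1, the capped-ℓ₁ function x ↦ Σᵢ min{1, θ|xᵢ|} plus α‖x‖₂² is not convex on ℝ^d. Consequently, the capped-ℓ₁ regularizer is not weakly convex. -/
/-- The one-dimensional capped absolute value plus a quadratic fails midpoint convexity at its
concave kink `1 / θ`. -/
lemma not_convexOn_min_one_mul_abs_add_mul_sq {θ α : ℝ} (hθ : 0 < θ) (hα : 0 < α) :
    ¬ ConvexOn ℝ Set.univ (fun t : ℝ => min 1 (θ * |t|) + α * t ^ 2) := by
  intro h
  obtain ⟨ε, hε, hεθ, hεα⟩ : ∃ ε : ℝ, 0 < ε ∧ θ * ε < 1 ∧ 2 * α * ε < θ := by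
    have hD : 0 < 2 * α + θ ^ 2 := by positivity
    refine ⟨θ / (2 * α + θ ^ 2), by positivity, ?_, ?_⟩
    · rw [← mul_div_assoc, div_lt_one hD]
      nlinarith
    · rw [← mul_div_assoc, div_lt_iff₀ hD]
      nlinarith [pow_pos hθ 3]
  obtain ⟨t, ht⟩ : ∃ t : ℝ, θ * t = 1 := ⟨θ⁻¹, mul_inv_cancel₀ hθ.ne'⟩
  have hεt : ε < t := lt_of_mul_lt_mul_left (ht ▸ hεθ) hθ.le
  have hmid := h.2 (Set.mem_univ (t - ε)) (Set.mem_univ (t + ε))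
    (by norm_num : (0 : ℝ) ≤ 1 / 2) (by norm_num : (0 : ℝ) ≤ 1 / 2) (by norm_num)
  have hcenter : (1 / 2 : ℝ) • (t - ε) + (1 / 2 : ℝ) • (t + ε) = t := by
    simp only [smul_eq_mul]
    ring
  have hθε : 0 < θ * ε := mul_pos hθ hε
  rw [hcenter] at hmid
  simp only [smul_eq_mul] at hmid
  rw [abs_of_pos (by linarith : 0 < t), abs_of_pos (by linarith : 0 < t - ε),
    abs_of_pos (by linarith : 0 < t + ε), ht, min_self,
    min_eq_right (by linarith : θ * (t - ε) ≤ 1),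
    min_eq_left (by linarith : 1 ≤ θ * (t + ε))] at hmid
  nlinarith [mul_lt_mul_of_pos_right hεα hε]

/-- The capped-`ℓ₁` function plus a positive multiple of the squared Euclidean norm is not convex
in any positive dimension. -/
lemma not_convexOn_capped_l1_add_mul_norm_sq {ι : Type*} [Fintype ι] [Nonempty ι] {θ α : ℝ}
    (hθ : 0 < θ) (hα : 0 < α) :
    ¬ ConvexOn ℝ Set.univ
        (fun x : EuclideanSpace ℝ ι => (∑ i, min 1 (θ * |x i|)) + α * ‖x‖ ^ 2) := by
  classical
  intro h
  obtain ⟨j⟩ := ‹Nonempty ι›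
  refine not_convexOn_min_one_mul_abs_add_mul_sq hθ hα ?_
  have hline := h.comp_linearMap
    (LinearMap.toSpanSingleton ℝ _ (EuclideanSpace.single j (1 : ℝ)))
  rw [Set.preimage_univ] at hline
  refine hline.congr fun t _ => ?_
  have hsum : ∑ i, min 1 (θ * |(t • EuclideanSpace.single j (1 : ℝ)) i|) =
      min 1 (θ * |t|) := by
    rw [Finset.sum_eq_single j]
    · simp
    · intro i _ hij
      simp [hij]
    · simp
  simp only [Function.comp_apply, LinearMap.toSpanSingleton_apply, hsum]
  simp [norm_smul]


/-- For every `θ > 0`, `α > 0` and `d ≥ 1`, the capped-`ℓ₁` function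
`x ↦ Σᵢ min{1, θ|xᵢ|}` plus `α‖x‖₂²` is not convex on `ℝ^d`; consequently the
capped-`ℓ₁` regularizer is not weakly convex. -/
theorem capped_l1_not_weakly_convex (d : ℕ) (hd : 1 ≤ d) (θ α : ℝ)
    (hθ : 0 < θ) (hα : 0 < α) :
    ¬ ConvexOn ℝ Set.univ
        (fun x : EuclideanSpace ℝ (Fin d) =>
          (∑ i, min 1 (θ * |x i|)) + α * ‖x‖ ^ 2) ∧
    ¬ ∃ ρ : ℝ, 0 < ρ ∧ ConvexOn ℝ Set.univ
        (fun x : EuclideanSpace ℝ (Fin d) =>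
          (∑ i, min 1 (θ * |x i|)) + ρ / 2 * ‖x‖ ^ 2) := by
  have : Nonempty (Fin d) := ⟨⟨0, hd⟩⟩
  refine ⟨not_convexOn_capped_l1_add_mul_norm_sq hθ hα, ?_⟩
  rintro ⟨ρ, hρ, h⟩
  exact not_convexOn_capped_l1_add_mul_norm_sq hθ (half_pos hρ) h
end

section
/- Let d and q be integers with 1 ≤ q ≤ d − 1, and define the top-q norm ‖x‖_{σq} as the sum of the q largest values among |x₁|, …, |x_d|. Then for every α > 0 the function x ↦ ‖x‖₁ − ‖x‖_{σq} + α‖x‖₂² is not convex on ℝ^d. Consequently, the ℓ₁ − ℓ_{σq} regularizer is not weakly convex. -/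
/-- The top-`q` norm on `ℝ^d`: the maximum over all index sets `S` of cardinality `q`
of `Σ_{i ∈ S} |xᵢ|`; for `1 ≤ q ≤ d` this equals the sum of the `q` largest `|xᵢ|`. -/
noncomputable def topQNorm (d q : ℕ) (x : EuclideanSpace ℝ (Fin d)) : ℝ :=
  sSup ((fun S : Finset (Fin d) => ∑ i ∈ S, |x i|) '' {S | S.card = q})

theorem bddAbove_topQNorm_image (d q : ℕ) (x : EuclideanSpace ℝ (Fin d)) :
    BddAbove ((fun S : Finset (Fin d) => ∑ i ∈ S, |x i|) '' {S | S.card = q}) :=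
  ((Set.toFinite _).image _).bddAbove

theorem sum_abs_le_topQNorm {d q : ℕ} (x : EuclideanSpace ℝ (Fin d)) {S : Finset (Fin d)}
    (hS : S.card = q) : ∑ i ∈ S, |x i| ≤ topQNorm d q x :=
  le_csSup (bddAbove_topQNorm_image d q x) ⟨S, hS, rfl⟩

/-- If `x` is supported on a set of at most `q` indices, its `ℓ₁` norm is at most its
top-`q` norm. -/
theorem sum_abs_le_topQNorm_of_support {d q : ℕ} (x : EuclideanSpace ℝ (Fin d))
    {S : Finset (Fin d)} (hS : S.card = q) (hx : ∀ i ∉ S, x i = 0) :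
    ∑ i, |x i| ≤ topQNorm d q x := by
  rw [← Finset.sum_subset (Finset.subset_univ S) fun i _ hi => by simp [hx i hi]]
  exact sum_abs_le_topQNorm x hS

theorem topQNorm_le_mul {d q : ℕ} (hqd : q ≤ d) (x : EuclideanSpace ℝ (Fin d)) {c : ℝ}
    (hx : ∀ i, |x i| ≤ c) : topQNorm d q x ≤ q * c := by
  obtain ⟨S₀, -, hS₀⟩ := Finset.exists_subset_card_eq
    (s := (Finset.univ : Finset (Fin d))) (n := q) (by simpa using hqd)
  refine csSup_le ⟨_, S₀, hS₀, rfl⟩ ?_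
  rintro _ ⟨S, hS, rfl⟩
  simpa [show S.card = q from hS] using Finset.sum_le_card_nsmul S _ c fun i _ => hx i

/-- Adding a positive multiple of the squared Euclidean norm does not make `‖·‖₁ - ‖·‖_{σq}`
convex. -/
theorem not_convexOn_l1_sub_topQNorm_add_sq {d q : ℕ} (hq : 1 ≤ q) (hqd : q + 1 ≤ d)
    {α : ℝ} (hα : 0 < α) :
    ¬ ConvexOn ℝ Set.univ
        (fun x : EuclideanSpace ℝ (Fin d) =>
          (∑ i, |x i|) - topQNorm d q x + α * ‖x‖ ^ 2) := by
  intro hconv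
  obtain ⟨T, -, hT⟩ := Finset.exists_subset_card_eq
    (s := (Finset.univ : Finset (Fin d))) (n := q + 1) (by simpa using hqd)
  obtain ⟨a, ha, b, hb, hab⟩ := Finset.one_lt_card.mp (show 1 < T.card by omega)
  set h : ℝ := 1 / (4 * α) with hh
  have hpos : 0 < h := by positivity
  let m : EuclideanSpace ℝ (Fin d) := WithLp.toLp 2 fun i => if i ∈ T then h else 0
  let v : EuclideanSpace ℝ (Fin d) := EuclideanSpace.single a h - EuclideanSpace.single b h
  have hm (i) : m i = if i ∈ T then h else 0 := rfl
  have hv (i) : v i = (if i = a then h else 0) - (if i = b then h else 0) := by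
    simp [v]
  have hplus : ∑ i, |(m + v) i| ≤ topQNorm d q (m + v) := by
    refine sum_abs_le_topQNorm_of_support _ (S := T.erase b)
      (by rw [Finset.card_erase_of_mem hb, hT, Nat.add_sub_cancel]) fun i hi => ?_
    rw [PiLp.add_apply, hm, hv]
    grind
  have hminus : ∑ i, |(m - v) i| ≤ topQNorm d q (m - v) := by
    refine sum_abs_le_topQNorm_of_support _ (S := T.erase a)
      (by rw [Finset.card_erase_of_mem ha, hT, Nat.add_sub_cancel]) fun i hi => ?_
    rw [PiLp.sub_apply, hm, hv]
    grind
  have hmid : topQNorm d q m ≤ q * h :=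
    topQNorm_le_mul (by omega) m fun i => by
      rw [hm]; split_ifs <;> simp [abs_of_pos hpos, hpos.le]
  have hl1 : ∑ i, |m i| = (q + 1) * h := by
    simp [hm, apply_ite abs, abs_of_pos hpos, Finset.sum_ite_mem, hT]
  have hvnorm : ‖v‖ ^ 2 = 2 * h ^ 2 := by
    have hsq (i) : v i ^ 2 = (if i = a then h ^ 2 else 0) + (if i = b then h ^ 2 else 0) := by
      rw [hv]; grind
    rw [EuclideanSpace.real_norm_sq_eq]
    simp only [hsq, Finset.sum_add_distrib, Finset.sum_ite_eq', Finset.mem_univ, if_true]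
    ring
  have hpar := parallelogram_law_with_norm ℝ m v
  have hc := hconv.2 (Set.mem_univ (m + v)) (Set.mem_univ (m - v))
    (show (0 : ℝ) ≤ 1 / 2 by norm_num) (show (0 : ℝ) ≤ 1 / 2 by norm_num) (by norm_num)
  have hcomb : (1 / 2 : ℝ) • (m + v) + (1 / 2 : ℝ) • (m - v) = m := by module
  rw [hcomb] at hc
  simp only [smul_eq_mul] at hc
  have hαh : α * h = 1 / 4 := by rw [hh]; field_simp
  have hsum : α * ‖m + v‖ ^ 2 + α * ‖m - v‖ ^ 2 = 2 * (α * ‖m‖ ^ 2) + h := by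
    linear_combination α * hpar + 2 * α * hvnorm + 4 * h * hαh
  linarith

/-- For `1 ≤ q ≤ d − 1` and any `α > 0`, the function
`x ↦ ‖x‖₁ − ‖x‖_{σq} + α‖x‖₂²` is not convex on `ℝ^d`; consequently the
`ℓ₁ − ℓ_{σq}` regularizer is not weakly convex. -/
theorem l1_sub_topq_not_weakly_convex (d q : ℕ) (hq : 1 ≤ q) (hqd : q ≤ d - 1)
    (α : ℝ) (hα : 0 < α) :
    ¬ ConvexOn ℝ Set.univ
        (fun x : EuclideanSpace ℝ (Fin d) =>
          (∑ i, |x i|) - topQNorm d q x + α * ‖x‖ ^ 2) ∧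
    ¬ ∃ ρ : ℝ, 0 < ρ ∧ ConvexOn ℝ Set.univ
        (fun x : EuclideanSpace ℝ (Fin d) =>
          ((∑ i, |x i|) - topQNorm d q x) + ρ / 2 * ‖x‖ ^ 2) := by
  have hqd' : q + 1 ≤ d := by omega
  refine ⟨not_convexOn_l1_sub_topQNorm_add_sq hq hqd' hα, ?_⟩
  rintro ⟨ρ, hρ, hconv⟩
  exact not_convexOn_l1_sub_topQNorm_add_sq hq hqd' (half_pos hρ) hconv
end

section
/- Let p ∈ (1, 2) and let d ≥ 1. Define g : ℝ^d → ℝ^d by g(x) = ‖x‖^{p−2} x for x ≠ 0 and g(0) = 0 (g is the gradient of x ↦ (1/p)·d/dx of ‖x‖^p up to the factor p, i.e., ∇(‖·‖^p)(x) = p·g(x)). Then there exists C > 0 such that ‖g(x) − g(y)‖ ≤ C ‖x − y‖^{p−1} for all x, y ∈ ℝ^d. In particular, x ↦ ‖x‖^p has (p−1)-Hölder continuous gradient. -/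
open Classical

section

variable {E : Type*} [NormedAddCommGroup E] [NormedSpace ℝ E]

theorem norm_rpow_smul_sub_rpow_smul_le_of_norm_le {p : ℝ} (hp1 : 1 < p) (hp2 : p < 2)
    {x y : E} (hxy : ‖y‖ ≤ ‖x‖) :
    ‖‖x‖ ^ (p - 2) • x - ‖y‖ ^ (p - 2) • y‖ ≤ 4 * ‖x - y‖ ^ (p - 1) := by
  rcases (norm_nonneg x).eq_or_lt with hx | hx
  · have hy : ‖y‖ = 0 := le_antisymm (hx ▸ hxy) (norm_nonneg y)
    rw [norm_eq_zero.1 hx.symm, norm_eq_zero.1 hy]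
    simp only [smul_zero, sub_self, norm_zero]
    positivity
  have hD : ‖x‖ - ‖y‖ ≤ ‖x - y‖ := norm_sub_norm_le x y
  have hD2 : ‖x - y‖ ≤ 2 * ‖x‖ := (norm_sub_le x y).trans (by linarith)
  have ha : 0 < ‖x‖ ^ (p - 2) := Real.rpow_pos_of_pos hx _
  have hradial : ‖(‖x‖ ^ (p - 2) - ‖y‖ ^ (p - 2)) • y‖ ≤ ‖x‖ ^ (p - 2) * ‖x - y‖ := by
    rcases (norm_nonneg y).eq_or_lt with hy | hy
    · rw [norm_smul, ← hy, mul_zero]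
      positivity
    have hle : ‖x‖ ^ (p - 2) ≤ ‖y‖ ^ (p - 2) :=
      Real.rpow_le_rpow_of_nonpos hy hxy (by linarith)
    have hmono : ‖y‖ ^ (p - 1) ≤ ‖x‖ ^ (p - 1) := by gcongr
    have hsplit : ∀ t : ℝ, 0 < t → t ^ (p - 1) = t ^ (p - 2) * t := fun t ht ↦ by
      rw [← Real.rpow_add_one ht.ne']
      ring_nf
    rw [hsplit _ hx, hsplit _ hy] at hmono
    rw [norm_smul, Real.norm_eq_abs, abs_sub_comm, abs_of_nonneg (sub_nonneg.2 hle)]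
    nlinarith [mul_le_mul_of_nonneg_left hD ha.le]
  have hdecomp : ‖x‖ ^ (p - 2) • x - ‖y‖ ^ (p - 2) • y
      = ‖x‖ ^ (p - 2) • (x - y) + (‖x‖ ^ (p - 2) - ‖y‖ ^ (p - 2)) • y := by
    module
  have hinterp : ‖x - y‖ ≤ ‖x - y‖ ^ (p - 1) * (2 * ‖x‖ ^ (2 - p)) := by
    have htwo : (2 : ℝ) ^ (2 - p) ≤ 2 := by
      simpa using Real.rpow_le_rpow_of_exponent_le one_le_two (by linarith : 2 - p ≤ 1)
    calc ‖x - y‖ = ‖x - y‖ ^ (p - 1) * ‖x - y‖ ^ (2 - p) := by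
          rw [← Real.rpow_add_of_nonneg (norm_nonneg _) (by linarith) (by linarith)]
          ring_nf
          simp
      _ ≤ ‖x - y‖ ^ (p - 1) * (2 * ‖x‖) ^ (2 - p) := by gcongr
      _ = ‖x - y‖ ^ (p - 1) * (2 ^ (2 - p) * ‖x‖ ^ (2 - p)) := by
          rw [Real.mul_rpow zero_le_two hx.le]
      _ ≤ ‖x - y‖ ^ (p - 1) * (2 * ‖x‖ ^ (2 - p)) := by gcongr
  have hcancel : ‖x‖ ^ (p - 2) * ‖x‖ ^ (2 - p) = 1 := by
    rw [← Real.rpow_add hx]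
    simp
  calc ‖‖x‖ ^ (p - 2) • x - ‖y‖ ^ (p - 2) • y‖
      ≤ ‖x‖ ^ (p - 2) * ‖x - y‖ + ‖x‖ ^ (p - 2) * ‖x - y‖ := by
        rw [hdecomp]
        refine (norm_add_le _ _).trans (add_le_add (le_of_eq ?_) hradial)
        rw [norm_smul, Real.norm_of_nonneg ha.le]
    _ = 2 * (‖x‖ ^ (p - 2) * ‖x - y‖) := by ring
    _ ≤ 2 * (‖x‖ ^ (p - 2) * (‖x - y‖ ^ (p - 1) * (2 * ‖x‖ ^ (2 - p)))) := by gcongr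
    _ = 4 * ‖x - y‖ ^ (p - 1) * (‖x‖ ^ (p - 2) * ‖x‖ ^ (2 - p)) := by ring
    _ = 4 * ‖x - y‖ ^ (p - 1) := by rw [hcancel, mul_one]

theorem norm_rpow_smul_sub_rpow_smul_le {p : ℝ} (hp1 : 1 < p) (hp2 : p < 2) (x y : E) :
    ‖‖x‖ ^ (p - 2) • x - ‖y‖ ^ (p - 2) • y‖ ≤ 4 * ‖x - y‖ ^ (p - 1) := by
  rcases le_total ‖y‖ ‖x‖ with h | h
  · exact norm_rpow_smul_sub_rpow_smul_le_of_norm_le hp1 hp2 h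
  · rw [norm_sub_rev, norm_sub_rev x y]
    exact norm_rpow_smul_sub_rpow_smul_le_of_norm_le hp1 hp2 h

end

/-- For `p ∈ (1, 2)` and `d ≥ 1`, the map
`g(x) = ‖x‖^{p−2} x` (with `g(0) = 0`), i.e. `(1/p)·∇(‖·‖^p)`, is `(p−1)`-Hölder
continuous: there is `C > 0` with `‖g(x) − g(y)‖ ≤ C‖x − y‖^{p−1}` for all `x, y`. -/
theorem norm_pow_gradient_holder (p : ℝ) (hp1 : 1 < p) (hp2 : p < 2)
    (d : ℕ) (hd : 1 ≤ d) :
    ∃ C : ℝ, 0 < C ∧ ∀ x y : EuclideanSpace ℝ (Fin d),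
      ‖(if x = 0 then (0 : EuclideanSpace ℝ (Fin d)) else ‖x‖ ^ (p - 2) • x)
        - (if y = 0 then (0 : EuclideanSpace ℝ (Fin d)) else ‖y‖ ^ (p - 2) • y)‖
        ≤ C * ‖x - y‖ ^ (p - 1) := by
  have hg : ∀ x : EuclideanSpace ℝ (Fin d),
      (if x = 0 then 0 else ‖x‖ ^ (p - 2) • x) = ‖x‖ ^ (p - 2) • x := fun x ↦ by
    split_ifs with hx
    · rw [hx, smul_zero]
    · rfl
  refine ⟨4, by norm_num, fun x y ↦ ?_⟩
  rw [hg, hg]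
  exact norm_rpow_smul_sub_rpow_smul_le hp1 hp2 x y
end
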